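/- Fix p ∈ (0,1) and constants h, l > 0. Then there exists C > 0 such that for every λ ∈ (1−p, 1), setting w = C·log(1/(1−λ)), one has 1 + h·w·exp(−l·w) ≤ p·λ/(λ − (1−p)). Equivalently, h·w·exp(−l·w) ≤ (1−p)(1−λ)/(λ−(1−p)) for all λ ∈ (1−p,1). -/

import Mathlib

/-- A linear-times-exponential bound: half of the decay rate absorbs the linear factor. -/
theorem mul_exp_neg_mul_le {l : ℝ} (hl : 0 < l) (w : ℝ) :
    w * Real.exp (-l * w) ≤ 2 / l * Real.exp (-(l * w / 2)) := by
  have hw : w ≤ 2 / l * Real.exp (l * w / 2) := by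
    have h := Real.add_one_le_exp (l * w / 2)
    rw [div_mul_eq_mul_div, le_div_iff₀ hl]
    linarith
  calc w * Real.exp (-l * w)
      ≤ 2 / l * Real.exp (l * w / 2) * Real.exp (-l * w) := by gcongr
    _ = 2 / l * Real.exp (-(l * w / 2)) := by
      rw [mul_assoc, ← Real.exp_add]
      ring_nf

/-- for fixed `p ∈ (0,1)` and `h, l > 0` there is `C > 0` such that, with
`w = C·log(1/(1−λ))`, one has `1 + h·w·exp(−l·w) ≤ p·λ/(λ−(1−p))`, equivalently
`h·w·exp(−l·w) ≤ (1−p)(1−λ)/(λ−(1−p))`, for all `λ ∈ (1−p,1)`. -/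
theorem lookahead_window_inequality (p : ℝ) (hp : p ∈ Set.Ioo (0:ℝ) 1)
    (h l : ℝ) (hh : 0 < h) (hl : 0 < l) :
    ∃ C > 0, ∀ lam ∈ Set.Ioo (1 - p) 1,
      (1 + h * (C * Real.log (1 / (1 - lam)))
            * Real.exp (-l * (C * Real.log (1 / (1 - lam))))
          ≤ p * lam / (lam - (1 - p))) ∧
      (h * (C * Real.log (1 / (1 - lam)))
            * Real.exp (-l * (C * Real.log (1 / (1 - lam))))
          ≤ (1 - p) * (1 - lam) / (lam - (1 - p))) := by
  obtain ⟨hp0, hp1⟩ := hp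
  have ha : 0 < Real.log (1 / p) := Real.log_pos (by rwa [one_lt_div hp0])
  have hq : 0 < (1 - p) / p := div_pos (by linarith) hp0
  set a := Real.log (1 / p)
  set q := (1 - p) / p with hq_def
  set K := h * (2 / l) / (q * a) with hK_def
  have hK : 0 < K := by positivity
  refine ⟨2 * (1 + K) / l, by positivity, ?_⟩
  rintro lam ⟨hlam0, hlam1⟩
  have hε : 0 < 1 - lam := by linarith
  have hd : 0 < lam - (1 - p) := by linarith
  set L := Real.log (1 / (1 - lam)) with hL_def
  have haL : a ≤ L :=
    Real.log_le_log (by positivity) (one_div_le_one_div_of_le hε (by linarith))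
  have hexpL : Real.exp (-L) = 1 - lam := by
    rw [hL_def, one_div, Real.log_inv, neg_neg, Real.exp_log hε]
  have hKL : h * (2 / l) ≤ q * Real.exp (K * L) := by
    have h1 := Real.add_one_le_exp (K * L)
    have h2 : K * a ≤ K * L := by gcongr
    calc h * (2 / l) = q * (K * a) := by rw [hK_def]; field_simp
      _ ≤ q * Real.exp (K * L) := by gcongr; linarith
  have key : h * (2 * (1 + K) / l * L) * Real.exp (-l * (2 * (1 + K) / l * L))
      ≤ (1 - p) * (1 - lam) / (lam - (1 - p)) := by
    have hrate : -(l * (2 * (1 + K) / l * L) / 2) = -(K * L) + -L := by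
      field_simp
      ring
    have hbound := mul_exp_neg_mul_le hl (2 * (1 + K) / l * L)
    rw [hrate, Real.exp_add, hexpL] at hbound
    calc h * (2 * (1 + K) / l * L) * Real.exp (-l * (2 * (1 + K) / l * L))
        ≤ h * (2 / l * (Real.exp (-(K * L)) * (1 - lam))) := by
          rw [mul_assoc]
          gcongr
      _ = h * (2 / l) * (Real.exp (-(K * L)) * (1 - lam)) := by ring
      _ ≤ q * Real.exp (K * L) * (Real.exp (-(K * L)) * (1 - lam)) := by gcongr
      _ = q * (1 - lam) := by
          rw [Real.exp_neg]
          field_simp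
      _ = (1 - p) * (1 - lam) / p := by rw [hq_def]; ring
      _ ≤ (1 - p) * (1 - lam) / (lam - (1 - p)) := by
          have : 0 ≤ 1 - p := by linarith
          gcongr
          linarith
  have hsplit : p * lam / (lam - (1 - p))
      = 1 + (1 - p) * (1 - lam) / (lam - (1 - p)) := by
    rw [eq_comm, one_add_div hd.ne']
    ring
  exact ⟨by rw [hsplit]; linarith, key⟩
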